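/- arXiv:1405.5807 — 18 statements merged into one kernel-verified Lean document; each statement's English description precedes it below -/
import Mathlib

section
/- Let (X, ∧) be a meet-semilattice with greatest element 1 and let ∼ and ∽ be two binary operations on X satisfying the Jenei–Kórodi axioms (F2')–(F7'). Then a ∼ b = a ∽ b for all a, b ∈ X; in particular every pseudo equality algebra in the sense of Jenei and Kórodi is an equality algebra. -/
/-- Every pseudo equality algebra in the sense of Jenei and Kórodi (axioms (F2')–(F7'))
satisfies `a ∼ b = a ∽ b`, hence is an equality algebra. -/
theorem jenei_korodi_pseudo_equality_is_equality (X : Type*) [SemilatticeInf X] [OrderTop X]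
    (sim bsim : X → X → X)
    (F2' : ∀ a b : X, sim a b = sim b a ∧ bsim a b = bsim b a)
    (F3' : ∀ a : X, sim a a = ⊤ ∧ bsim a a = ⊤)
    (F4' : ∀ a : X, sim a ⊤ = a ∧ bsim a ⊤ = a)
    (F5' : ∀ a b c : X, a ≤ b → b ≤ c →
      sim a c ≤ sim b c ∧ sim a c ≤ sim a b ∧ bsim c a ≤ bsim c b ∧ bsim c a ≤ bsim b a)
    (F6' : ∀ a b c : X, sim a b ≤ sim (a ⊓ c) (b ⊓ c) ∧ bsim a b ≤ bsim (a ⊓ c) (b ⊓ c))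
    (F7' : ∀ a b c : X, sim a b ≤ bsim (sim a c) (sim b c) ∧ bsim a b ≤ sim (bsim a c) (bsim b c)) :
    ∀ a b : X, sim a b = bsim a b := by
  intro a b
  apply le_antisymm
  · simpa only [(F4' _).1] using (F7' a b ⊤).1
  · simpa only [(F4' _).2] using (F7' a b ⊤).2
end

section
/- Let (X; ∼, ∽, ∧, 1) be a pseudo equality algebra such that ∼ and ∽ are commutative binary operations on X (a ∼ b = b ∼ a and a ∽ b = b ∽ a for all a, b). Then ∼ = ∽, i.e., a ∼ b = a ∽ b for all a, b ∈ X. -/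
/-- In a pseudo equality algebra in which `∼` and `∽` are both commutative,
the two operations coincide. -/
theorem pseudoEquality_comm_implies_eq (X : Type*) [SemilatticeInf X] [OrderTop X]
    (sim bsim : X → X → X)
    (F2 : ∀ a : X, sim a a = ⊤ ∧ bsim a a = ⊤)
    (F3 : ∀ a : X, sim a ⊤ = a ∧ bsim ⊤ a = a)
    (F4 : ∀ a b c : X, a ≤ b → b ≤ c →
      sim a c ≤ sim b c ∧ sim a c ≤ sim a b ∧ bsim c a ≤ bsim c b ∧ bsim c a ≤ bsim b a)
    (F5 : ∀ a b c : X, sim a b ≤ sim (a ⊓ c) (b ⊓ c) ∧ bsim a b ≤ bsim (a ⊓ c) (b ⊓ c))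
    (F6 : ∀ a b c : X, sim a b ≤ bsim (sim c a) (sim c b) ∧ bsim a b ≤ sim (bsim a c) (bsim b c))
    (F7 : ∀ a b c : X, sim a b ≤ sim (sim a c) (sim b c) ∧ bsim a b ≤ bsim (bsim c a) (bsim c b))
    (hsim_comm : ∀ a b : X, sim a b = sim b a)
    (hbsim_comm : ∀ a b : X, bsim a b = bsim b a) :
    ∀ a b : X, sim a b = bsim a b := by
  intro a b
  have sim_top_left (x : X) : sim ⊤ x = x := (hsim_comm ⊤ x).trans (F3 x).1
  have bsim_top_right (x : X) : bsim x ⊤ = x := (hbsim_comm x ⊤).trans (F3 x).2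
  apply le_antisymm
  · simpa only [sim_top_left] using (F6 a b ⊤).1
  · simpa only [bsim_top_right] using (F6 a b ⊤).2
end

section
/- Let (X; ∼, ∽, ∧, 1) be a pseudo equality algebra such that 1 ∼ a = a = a ∽ 1 for all a ∈ X. Then ∼ = ∽ and both operations are commutative (so X is an equality algebra under ∼). -/
/-- If a pseudo equality algebra satisfies `1 ∼ a = a = a ∽ 1`, then `∼ = ∽` and both
operations are commutative, so `X` is an equality algebra under `∼`. -/
theorem pseudoEquality_of_unit_condition (X : Type*) [SemilatticeInf X] [OrderTop X]
    (sim bsim : X → X → X)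
    (F2 : ∀ a : X, sim a a = ⊤ ∧ bsim a a = ⊤)
    (F3 : ∀ a : X, sim a ⊤ = a ∧ bsim ⊤ a = a)
    (F4 : ∀ a b c : X, a ≤ b → b ≤ c →
      sim a c ≤ sim b c ∧ sim a c ≤ sim a b ∧ bsim c a ≤ bsim c b ∧ bsim c a ≤ bsim b a)
    (F5 : ∀ a b c : X, sim a b ≤ sim (a ⊓ c) (b ⊓ c) ∧ bsim a b ≤ bsim (a ⊓ c) (b ⊓ c))
    (F6 : ∀ a b c : X, sim a b ≤ bsim (sim c a) (sim c b) ∧ bsim a b ≤ sim (bsim a c) (bsim b c))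
    (F7 : ∀ a b c : X, sim a b ≤ sim (sim a c) (sim b c) ∧ bsim a b ≤ bsim (bsim c a) (bsim c b))
    (h : ∀ a : X, sim ⊤ a = a ∧ bsim a ⊤ = a) :
    (∀ a b : X, sim a b = bsim a b) ∧ (∀ a b : X, sim a b = sim b a) ∧
      (∀ a b : X, bsim a b = bsim b a) := by
  have sim_eq_bsim : ∀ a b : X, sim a b = bsim a b := fun a b =>
    le_antisymm (by simpa only [(h _).1] using (F6 a b ⊤).1)
      (by simpa only [(h _).2] using (F6 a b ⊤).2)
  have sim_le_swap : ∀ a b : X, sim a b ≤ sim b a := fun a b => by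
    simpa only [(F2 a).1, (h _).1] using (F7 a b a).1
  have sim_comm : ∀ a b : X, sim a b = sim b a := fun a b =>
    le_antisymm (sim_le_swap a b) (sim_le_swap b a)
  exact ⟨sim_eq_bsim, sim_comm, fun a b => by
    rw [← sim_eq_bsim, ← sim_eq_bsim, sim_comm]⟩
end

section
/- Let G be a lattice-ordered group (a group with a lattice order in which multiplication is monotone on both sides), with identity element e, and let G⁻ = {g ∈ G : g ≤ e} be its negative cone. Define on G⁻ the operations a ∼ b = (a · b⁻¹) ⊓ e and a ∽ b = (a⁻¹ · b) ⊓ e. Then (G⁻; ∼, ∽, ⊓, e) is a pseudo equality algebra, i.e., these operations on the meet-semilattice G⁻ with greatest element e satisfy axioms (F2)–(F7). -/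
/-- `a ∼ b := (a * b⁻¹) ⊓ 1` on the negative cone of a lattice-ordered group. -/
def negConeSim {G : Type*} [Lattice G] [Group G] (a b : G) : G := (a * b⁻¹) ⊓ 1

/-- `a ∽ b := (a⁻¹ * b) ⊓ 1` on the negative cone of a lattice-ordered group. -/
def negConeBsim {G : Type*} [Lattice G] [Group G] (a b : G) : G := (a⁻¹ * b) ⊓ 1

section
variable {G : Type*} [Lattice G] [Group G] {a b x : G}

theorem negConeSim_le_one : negConeSim a b ≤ 1 := inf_le_right

theorem negConeBsim_le_one : negConeBsim a b ≤ 1 := inf_le_right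

theorem le_negConeSim_iff [MulRightMono G] : x ≤ negConeSim a b ↔ x * b ≤ a ∧ x ≤ 1 := by
  rw [negConeSim, le_inf_iff, le_mul_inv_iff_mul_le]

theorem le_negConeBsim_iff [MulLeftMono G] : x ≤ negConeBsim a b ↔ a * x ≤ b ∧ x ≤ 1 := by
  rw [negConeBsim, le_inf_iff, le_inv_mul_iff_mul_le]

theorem negConeSim_mul_le [MulRightMono G] : negConeSim a b * b ≤ a := (le_negConeSim_iff.1 le_rfl).1

theorem mul_negConeBsim_le [MulLeftMono G] : a * negConeBsim a b ≤ b := (le_negConeBsim_iff.1 le_rfl).1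

variable [MulLeftMono G] [MulRightMono G]

theorem negConeSim_mono {a' b' : G} (ha : a ≤ a') (hb : b' ≤ b) :
    negConeSim a b ≤ negConeSim a' b' :=
  inf_le_inf_right _ (mul_le_mul' ha (inv_le_inv_iff.2 hb))

theorem negConeBsim_mono {a' b' : G} (ha : a' ≤ a) (hb : b ≤ b') :
    negConeBsim a b ≤ negConeBsim a' b' :=
  inf_le_inf_right _ (mul_le_mul' (inv_le_inv_iff.2 ha) hb)

theorem negConeSim_mul_negConeSim_le (a b c : G) :
    negConeSim a b * negConeSim b c ≤ negConeSim a c := by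
  refine le_negConeSim_iff.2 ⟨?_, mul_le_one' negConeSim_le_one negConeSim_le_one⟩
  rw [mul_assoc]
  exact (mul_le_mul_right negConeSim_mul_le _).trans negConeSim_mul_le

theorem negConeBsim_mul_negConeBsim_le (a b c : G) :
    negConeBsim a b * negConeBsim b c ≤ negConeBsim a c := by
  refine le_negConeBsim_iff.2 ⟨?_, mul_le_one' negConeBsim_le_one negConeBsim_le_one⟩
  rw [← mul_assoc]
  exact (mul_le_mul_left mul_negConeBsim_le _).trans mul_negConeBsim_le

theorem negConeSim_le_negConeSim_inf (a b c : G) :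
    negConeSim a b ≤ negConeSim (a ⊓ c) (b ⊓ c) :=
  le_negConeSim_iff.2 ⟨le_inf
    ((mul_le_mul_right inf_le_left _).trans negConeSim_mul_le)
    ((mul_le_of_le_one_left' negConeSim_le_one).trans inf_le_right), negConeSim_le_one⟩

theorem negConeBsim_le_negConeBsim_inf (a b c : G) :
    negConeBsim a b ≤ negConeBsim (a ⊓ c) (b ⊓ c) :=
  le_negConeBsim_iff.2 ⟨le_inf
    ((mul_le_mul_left inf_le_left _).trans mul_negConeBsim_le)
    ((mul_le_of_le_one_right' negConeBsim_le_one).trans inf_le_right), negConeBsim_le_one⟩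

end

/-- The negative cone of a lattice-ordered group, equipped with `a ∼ b = (a * b⁻¹) ⊓ e` and
`a ∽ b = (a⁻¹ * b) ⊓ e`, is a pseudo equality algebra: the axioms (F2)–(F7) hold (with the
meet of `G` and top element `e = 1`). -/
theorem negCone_pseudoEqualityAlgebra (G : Type*) [Lattice G] [Group G]
    [CovariantClass G G (· * ·) (· ≤ ·)] [CovariantClass G G (Function.swap (· * ·)) (· ≤ ·)] :
    ∀ a b c : G, a ≤ 1 → b ≤ 1 → c ≤ 1 →
      (negConeSim a a = 1 ∧ negConeBsim a a = 1) ∧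
      (negConeSim a 1 = a ∧ negConeBsim 1 a = a) ∧
      (a ≤ b → b ≤ c →
        negConeSim a c ≤ negConeSim b c ∧ negConeSim a c ≤ negConeSim a b ∧
        negConeBsim c a ≤ negConeBsim c b ∧ negConeBsim c a ≤ negConeBsim b a) ∧
      (negConeSim a b ≤ negConeSim (a ⊓ c) (b ⊓ c) ∧
        negConeBsim a b ≤ negConeBsim (a ⊓ c) (b ⊓ c)) ∧
      (negConeSim a b ≤ negConeBsim (negConeSim c a) (negConeSim c b) ∧
        negConeBsim a b ≤ negConeSim (negConeBsim a c) (negConeBsim b c)) ∧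
      (negConeSim a b ≤ negConeSim (negConeSim a c) (negConeSim b c) ∧
        negConeBsim a b ≤ negConeBsim (negConeBsim c a) (negConeBsim c b)) := by
  intro a b c ha _ _
  refine ⟨⟨by simp [negConeSim], by simp [negConeBsim]⟩,
    ⟨by simpa [negConeSim] using ha, by simpa [negConeBsim] using ha⟩,
    fun hab hbc => ⟨negConeSim_mono hab le_rfl, negConeSim_mono le_rfl hbc,
      negConeBsim_mono le_rfl hab, negConeBsim_mono hbc le_rfl⟩,
    ⟨negConeSim_le_negConeSim_inf a b c, negConeBsim_le_negConeBsim_inf a b c⟩,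
    ⟨le_negConeBsim_iff.2 ⟨negConeSim_mul_negConeSim_le c a b, negConeSim_le_one⟩,
      le_negConeSim_iff.2 ⟨negConeBsim_mul_negConeBsim_le a b c, negConeBsim_le_one⟩⟩,
    ⟨le_negConeSim_iff.2 ⟨negConeSim_mul_negConeSim_le a b c, negConeSim_le_one⟩,
      le_negConeBsim_iff.2 ⟨negConeBsim_mul_negConeBsim_le c a b, negConeBsim_le_one⟩⟩⟩
end

section
/- Let (X; ∼, ∽, ∧, 1) be a pseudo equality algebra. Then for all a, b, c ∈ X: (i) a ∽ b ≤ a ⇝ b and b ∼ a ≤ a → b; (ii) a ≤ ((c ∼ a) ∽ c) ∧ (c ∼ (a ∽ c)); (iii) if a ∽ b = 1 or b ∼ a = 1, then a ≤ b; (iv) a ∼ b = 1 implies c ∼ a ≤ c ∼ b, and a ∽ b = 1 implies b ∽ c ≤ a ∽ c; (v) a ≤ b if and only if a → b = 1, if and only if a ⇝ b = 1. -/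
/-- Derived implication `a → b := (a ∧ b) ∼ a` of a pseudo equality algebra. -/
def arr {X : Type*} [SemilatticeInf X] (sim : X → X → X) (a b : X) : X := sim (a ⊓ b) a

/-- Derived implication `a ⇝ b := a ∽ (a ∧ b)` of a pseudo equality algebra. -/
def warr {X : Type*} [SemilatticeInf X] (bsim : X → X → X) (a b : X) : X := bsim a (a ⊓ b)

/-- Proposition 3.5 (i)–(v) for pseudo equality algebras. -/
theorem pseudoEquality_prop_3_5_i_v (X : Type*) [SemilatticeInf X] [OrderTop X]
    (sim bsim : X → X → X)
    (F2 : ∀ a : X, sim a a = ⊤ ∧ bsim a a = ⊤)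
    (F3 : ∀ a : X, sim a ⊤ = a ∧ bsim ⊤ a = a)
    (F4 : ∀ a b c : X, a ≤ b → b ≤ c →
      sim a c ≤ sim b c ∧ sim a c ≤ sim a b ∧ bsim c a ≤ bsim c b ∧ bsim c a ≤ bsim b a)
    (F5 : ∀ a b c : X, sim a b ≤ sim (a ⊓ c) (b ⊓ c) ∧ bsim a b ≤ bsim (a ⊓ c) (b ⊓ c))
    (F6 : ∀ a b c : X, sim a b ≤ bsim (sim c a) (sim c b) ∧ bsim a b ≤ sim (bsim a c) (bsim b c))
    (F7 : ∀ a b c : X, sim a b ≤ sim (sim a c) (sim b c) ∧ bsim a b ≤ bsim (bsim c a) (bsim c b)) :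
    ∀ a b c : X,
      (bsim a b ≤ warr bsim a b ∧ sim b a ≤ arr sim a b) ∧
      (a ≤ bsim (sim c a) c ⊓ sim c (bsim a c)) ∧
      ((bsim a b = ⊤ ∨ sim b a = ⊤) → a ≤ b) ∧
      ((sim a b = ⊤ → sim c a ≤ sim c b) ∧ (bsim a b = ⊤ → bsim b c ≤ bsim a c)) ∧
      ((a ≤ b ↔ arr sim a b = ⊤) ∧ (a ≤ b ↔ warr bsim a b = ⊤)) := by
  have le_bsim_sim : ∀ a c : X, a ≤ bsim (sim c a) c := fun a c => by
    simpa only [(F3 _).1] using (F6 a ⊤ c).1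
  have le_sim_bsim : ∀ a c : X, a ≤ sim c (bsim a c) := fun a c => by
    simpa only [(F3 _).2] using (F6 ⊤ a c).2
  have le_of_bsim : ∀ a b : X, bsim a b = ⊤ → a ≤ b := fun a b h => by
    simpa only [h, (F3 _).1] using le_sim_bsim a b
  have le_of_sim : ∀ a b : X, sim b a = ⊤ → a ≤ b := fun a b h => by
    simpa only [h, (F3 _).2] using le_bsim_sim a b
  intro a b c
  refine ⟨⟨?_, ?_⟩, le_inf (le_bsim_sim a c) (le_sim_bsim a c),
    fun h => h.elim (le_of_bsim a b) (le_of_sim a b), ⟨fun h => ?_, fun h => ?_⟩,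
    ⟨fun h => ?_, fun h => ?_⟩, ⟨fun h => ?_, fun h => ?_⟩⟩
  · simpa only [warr, inf_idem, inf_comm b a] using (F5 a b a).2
  · simpa only [arr, inf_idem, inf_comm b a] using (F5 b a a).1
  · exact le_of_bsim _ _ (top_le_iff.mp (h ▸ (F6 a b c).1))
  · exact le_of_sim _ _ (top_le_iff.mp (h ▸ (F6 a b c).2))
  · rw [arr, inf_eq_left.mpr h, (F2 a).1]
  · exact (le_of_sim _ _ h).trans inf_le_right
  · rw [warr, inf_eq_left.mpr h, (F2 a).2]
  · exact (le_of_bsim _ _ h).trans inf_le_right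
end

section
/- Let (X; ∼, ∽, ∧, 1) be a pseudo equality algebra. Then for all a, b, c ∈ X: (vi) a ⇝ 1 = a ⇝ a = a → a = a → 1 = 1, 1 ⇝ a = a and 1 → a = a; (vii) a ≤ (b → a) ∧ (b ⇝ a); (viii) a ≤ ((a → b) ⇝ b) ∧ ((a ⇝ b) → b); (ix) a → b ≤ (b → c) ⇝ (a → c) and a ⇝ b ≤ (b ⇝ c) → (a ⇝ c). -/
/-- Proposition 3.5 (vi)–(ix) for pseudo equality algebras. -/
theorem pseudoEquality_prop_3_5_vi_ix (X : Type*) [SemilatticeInf X] [OrderTop X]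
    (sim bsim : X → X → X)
    (F2 : ∀ a : X, sim a a = ⊤ ∧ bsim a a = ⊤)
    (F3 : ∀ a : X, sim a ⊤ = a ∧ bsim ⊤ a = a)
    (F4 : ∀ a b c : X, a ≤ b → b ≤ c →
      sim a c ≤ sim b c ∧ sim a c ≤ sim a b ∧ bsim c a ≤ bsim c b ∧ bsim c a ≤ bsim b a)
    (F5 : ∀ a b c : X, sim a b ≤ sim (a ⊓ c) (b ⊓ c) ∧ bsim a b ≤ bsim (a ⊓ c) (b ⊓ c))
    (F6 : ∀ a b c : X, sim a b ≤ bsim (sim c a) (sim c b) ∧ bsim a b ≤ sim (bsim a c) (bsim b c))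
    (F7 : ∀ a b c : X, sim a b ≤ sim (sim a c) (sim b c) ∧ bsim a b ≤ bsim (bsim c a) (bsim c b)) :
    ∀ a b c : X,
      (warr bsim a ⊤ = ⊤ ∧ warr bsim a a = ⊤ ∧ arr sim a a = ⊤ ∧ arr sim a ⊤ = ⊤ ∧
        warr bsim ⊤ a = a ∧ arr sim ⊤ a = a) ∧
      (a ≤ arr sim b a ⊓ warr bsim b a) ∧
      (a ≤ warr bsim (arr sim a b) b ⊓ arr sim (warr bsim a b) b) ∧
      (arr sim a b ≤ warr bsim (arr sim b c) (arr sim a c) ∧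
        warr bsim a b ≤ arr sim (warr bsim b c) (warr bsim a c)) := by
  have le_arr (a b : X) : a ≤ sim (b ⊓ a) b := by
    simpa [(F3 a).1, inf_comm] using (F5 a ⊤ b).1
  have le_warr (a b : X) : a ≤ bsim b (b ⊓ a) := by
    simpa [(F3 a).2, inf_comm] using (F5 ⊤ a b).2
  intro a b c
  simp only [arr, warr]
  refine ⟨?_, le_inf (le_arr a b) (le_warr a b), le_inf ?_ ?_, ?_, ?_⟩
  · simp [F2, F3]
  · rw [inf_eq_right.2 (le_arr b a)]
    have h := (F6 a ⊤ (a ⊓ b)).1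
    rw [(F3 a).1, (F3 (a ⊓ b)).1] at h
    exact h.trans (F4 _ _ _ inf_le_right (le_arr b a)).2.2.1
  · rw [inf_eq_right.2 (le_warr b a)]
    have h := (F6 ⊤ a (a ⊓ b)).2
    rw [(F3 a).2, (F3 (a ⊓ b)).2] at h
    exact h.trans (F4 _ _ _ inf_le_right (le_warr b a)).1
  · have hp : sim (b ⊓ c) b ≤ sim (a ⊓ b ⊓ c) (a ⊓ b) := by
      simpa [inf_comm, inf_left_comm, inf_assoc] using (F5 (b ⊓ c) b a).1
    have hq : sim (a ⊓ b ⊓ c) a ≤ sim (a ⊓ c) a :=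
      (F4 _ _ _ (inf_le_inf_right c inf_le_left) inf_le_left).1
    calc sim (a ⊓ b) a
        ≤ bsim (sim (a ⊓ b ⊓ c) (a ⊓ b)) (sim (a ⊓ b ⊓ c) a) := (F6 _ _ _).1
      _ ≤ _ := (F5 _ _ (sim (b ⊓ c) b)).2
      _ = bsim (sim (b ⊓ c) b) (sim (b ⊓ c) b ⊓ sim (a ⊓ b ⊓ c) a) := by
        rw [inf_eq_right.2 hp, inf_comm (sim (a ⊓ b ⊓ c) a)]
      _ ≤ _ := (F4 _ _ _ (inf_le_inf_left _ hq) inf_le_left).2.2.1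
  · have hp : bsim b (b ⊓ c) ≤ bsim (a ⊓ b) (a ⊓ b ⊓ c) := by
      simpa [inf_comm, inf_left_comm, inf_assoc] using (F5 b (b ⊓ c) a).2
    have hq : bsim a (a ⊓ b ⊓ c) ≤ bsim a (a ⊓ c) :=
      (F4 _ _ _ (inf_le_inf_right c inf_le_left) inf_le_left).2.2.1
    calc bsim a (a ⊓ b)
        ≤ sim (bsim a (a ⊓ b ⊓ c)) (bsim (a ⊓ b) (a ⊓ b ⊓ c)) := (F6 _ _ _).2
      _ ≤ _ := (F5 _ _ (bsim b (b ⊓ c))).1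
      _ = sim (bsim b (b ⊓ c) ⊓ bsim a (a ⊓ b ⊓ c)) (bsim b (b ⊓ c)) := by
        rw [inf_eq_right.2 hp, inf_comm (bsim a (a ⊓ b ⊓ c))]
      _ ≤ _ := (F4 _ _ _ (inf_le_inf_left _ hq) inf_le_left).1
end

section
/- Let (X; ∼, ∽, ∧, 1) be a pseudo equality algebra. Then for all a, b, c ∈ X: (x) a ≤ b → c if and only if b ≤ a ⇝ c; (xi) a → (b ⇝ c) = b ⇝ (a → c); (xii) b → a ≤ (b ∧ c) → (a ∧ c) and b ⇝ a ≤ (b ∧ c) ⇝ (a ∧ c); (xiii) a → b = a → (a ∧ b) and a ⇝ b = a ⇝ (a ∧ b). -/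
theorem arr_inf_self_left {X : Type*} [SemilatticeInf X] (sim : X → X → X) (a b : X) :
    arr sim a (a ⊓ b) = arr sim a b := by
  simp [arr]

theorem arr_le_arr_inf_inf {X : Type*} [SemilatticeInf X] {sim : X → X → X}
    (sim_le_inf : ∀ a b c, sim a b ≤ sim (a ⊓ c) (b ⊓ c)) (a b c : X) :
    arr sim b a ≤ arr sim (b ⊓ c) (a ⊓ c) := by
  have h := sim_le_inf (b ⊓ a) b c
  rwa [inf_inf_distrib_right] at h

theorem le_warr_of_le_arr {X : Type*} [SemilatticeInf X] [OrderTop X] {sim bsim : X → X → X}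
    (sim_top : ∀ a, sim a ⊤ = a)
    (bsim_mono : ∀ a b c, a ≤ b → b ≤ c → bsim c a ≤ bsim c b)
    (bsim_le_inf : ∀ a b c, bsim a b ≤ bsim (a ⊓ c) (b ⊓ c))
    (sim_le_bsim : ∀ a b c, sim a b ≤ bsim (sim c a) (sim c b))
    {a b c : X} (h : a ≤ arr sim b c) : b ≤ warr bsim a c := by
  have hb : b ≤ bsim (sim (b ⊓ c) b) (b ⊓ c) := by
    simpa only [sim_top] using sim_le_bsim b ⊤ (b ⊓ c)
  have ha : sim (b ⊓ c) b ⊓ a = a := inf_eq_right.2 h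
  calc b ≤ bsim (sim (b ⊓ c) b) (b ⊓ c) := hb
    _ ≤ bsim a (b ⊓ c ⊓ a) := by simpa only [ha] using bsim_le_inf (sim (b ⊓ c) b) (b ⊓ c) a
    _ ≤ bsim a (a ⊓ c) :=
      bsim_mono _ _ _ (le_inf inf_le_right (inf_le_left.trans inf_le_right)) inf_le_left

theorem arr_le_arr_arr {X : Type*} [SemilatticeInf X] {sim : X → X → X}
    (sim_mono : ∀ a b c, a ≤ b → b ≤ c → sim a c ≤ sim b c)
    (sim_le_inf : ∀ a b c, sim a b ≤ sim (a ⊓ c) (b ⊓ c))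
    (sim_le_sim : ∀ a b c, sim a b ≤ sim (sim a c) (sim b c)) (u v w : X) :
    arr sim v w ≤ arr sim (arr sim u v) (arr sim u w) := by
  have hv : sim (v ⊓ w ⊓ u) u ≤ sim (v ⊓ u) u :=
    sim_mono _ _ _ (inf_le_inf_right u inf_le_left) inf_le_right
  have hw : sim (v ⊓ w ⊓ u) u ≤ sim (w ⊓ u) u :=
    sim_mono _ _ _ (inf_le_inf_right u inf_le_right) inf_le_right
  simp only [arr, inf_comm u]
  calc sim (v ⊓ w) v ≤ sim (v ⊓ w ⊓ u) (v ⊓ u) := sim_le_inf _ _ u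
    _ ≤ sim (sim (v ⊓ w ⊓ u) u) (sim (v ⊓ u) u) := sim_le_sim _ _ u
    _ ≤ sim (sim (v ⊓ u) u ⊓ sim (w ⊓ u) u) (sim (v ⊓ u) u) :=
      sim_mono _ _ _ (le_inf hv hw) inf_le_left

/-- Proposition 3.5 (x)–(xiii) for pseudo equality algebras. -/
theorem pseudoEquality_prop_3_5_x_xiii (X : Type*) [SemilatticeInf X] [OrderTop X]
    (sim bsim : X → X → X)
    (F2 : ∀ a : X, sim a a = ⊤ ∧ bsim a a = ⊤)
    (F3 : ∀ a : X, sim a ⊤ = a ∧ bsim ⊤ a = a)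
    (F4 : ∀ a b c : X, a ≤ b → b ≤ c →
      sim a c ≤ sim b c ∧ sim a c ≤ sim a b ∧ bsim c a ≤ bsim c b ∧ bsim c a ≤ bsim b a)
    (F5 : ∀ a b c : X, sim a b ≤ sim (a ⊓ c) (b ⊓ c) ∧ bsim a b ≤ bsim (a ⊓ c) (b ⊓ c))
    (F6 : ∀ a b c : X, sim a b ≤ bsim (sim c a) (sim c b) ∧ bsim a b ≤ sim (bsim a c) (bsim b c))
    (F7 : ∀ a b c : X, sim a b ≤ sim (sim a c) (sim b c) ∧ bsim a b ≤ bsim (bsim c a) (bsim c b)) :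
    ∀ a b c : X,
      (a ≤ arr sim b c ↔ b ≤ warr bsim a c) ∧
      (arr sim a (warr bsim b c) = warr bsim b (arr sim a c)) ∧
      (arr sim b a ≤ arr sim (b ⊓ c) (a ⊓ c) ∧ warr bsim b a ≤ warr bsim (b ⊓ c) (a ⊓ c)) ∧
      (arr sim a b = arr sim a (a ⊓ b) ∧ warr bsim a b = warr bsim a (a ⊓ b)) := by
  have adj (a b c : X) : a ≤ arr sim b c ↔ b ≤ warr bsim a c :=
    ⟨le_warr_of_le_arr (fun a => (F3 a).1) (fun a b c hab hbc => (F4 a b c hab hbc).2.2.1)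
      (fun a b c => (F5 a b c).2) (fun a b c => (F6 a b c).1),
    le_warr_of_le_arr (sim := flip bsim) (bsim := flip sim) (fun a => (F3 a).2)
      (fun a b c hab hbc => (F4 a b c hab hbc).1)
      (fun a b c => (F5 b a c).1) (fun a b c => (F6 b a c).2)⟩
  have trans_arr (u v w : X) : arr sim v w ≤ arr sim (arr sim u v) (arr sim u w) :=
    arr_le_arr_arr (fun a b c hab hbc => (F4 a b c hab hbc).1)
      (fun a b c => (F5 a b c).1) (fun a b c => (F7 a b c).1) u v w
  have trans_warr (u v w : X) : warr bsim v w ≤ warr bsim (warr bsim u v) (warr bsim u w) :=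
    arr_le_arr_arr (sim := flip bsim) (fun a b c hab hbc => (F4 a b c hab hbc).2.2.1)
      (fun a b c => (F5 b a c).2) (fun a b c => (F7 b a c).2) u v w
  refine fun a b c => ⟨adj a b c, le_antisymm ?_ ?_, ⟨?_, ?_⟩, ?_, ?_⟩
  · exact (adj _ _ _).1 (((adj _ _ _).2 le_rfl).trans (trans_arr a (warr bsim b c) c))
  · exact (adj _ _ _).2 (((adj _ _ _).1 le_rfl).trans (trans_warr b (arr sim a c) c))
  · exact arr_le_arr_inf_inf (fun a b c => (F5 a b c).1) a b c
  · exact arr_le_arr_inf_inf (sim := flip bsim) (fun a b c => (F5 b a c).2) a b c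
  · exact (arr_inf_self_left sim a b).symm
  · exact (arr_inf_self_left (flip bsim) a b).symm
end

section
/- Let (X; ∼, ∽, ∧, 1) be a pseudo equality algebra and define a → b := (a ∧ b) ∼ a and a ⇝ b := a ∽ (a ∧ b). Then (X; →, ⇝, ∧, 1) is a pseudo BCK-meet-semilattice satisfying condition (xii), i.e.: the axioms (PBCK1)–(PBCK3) hold, a ≤ b holds if and only if a → b = 1, if and only if a ⇝ b = 1 (so in particular a → b = 1 = b → a implies a = b), and b → a ≤ (b ∧ c) → (a ∧ c) and b ⇝ a ≤ (b ∧ c) ⇝ (a ∧ c) for all a, b, c ∈ X. -/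
/-- Theorem 4.2 (i): the derived operations `a → b := (a ∧ b) ∼ a` and `a ⇝ b := a ∽ (a ∧ b)`
of a pseudo equality algebra make it a pseudo BCK-meet-semilattice satisfying condition (xii). -/
theorem pseudoEquality_to_pseudoBCK (X : Type*) [SemilatticeInf X] [OrderTop X]
    (sim bsim : X → X → X)
    (F2 : ∀ a : X, sim a a = ⊤ ∧ bsim a a = ⊤)
    (F3 : ∀ a : X, sim a ⊤ = a ∧ bsim ⊤ a = a)
    (F4 : ∀ a b c : X, a ≤ b → b ≤ c →
      sim a c ≤ sim b c ∧ sim a c ≤ sim a b ∧ bsim c a ≤ bsim c b ∧ bsim c a ≤ bsim b a)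
    (F5 : ∀ a b c : X, sim a b ≤ sim (a ⊓ c) (b ⊓ c) ∧ bsim a b ≤ bsim (a ⊓ c) (b ⊓ c))
    (F6 : ∀ a b c : X, sim a b ≤ bsim (sim c a) (sim c b) ∧ bsim a b ≤ sim (bsim a c) (bsim b c))
    (F7 : ∀ a b c : X, sim a b ≤ sim (sim a c) (sim b c) ∧ bsim a b ≤ bsim (bsim c a) (bsim c b)) :
    (∀ a b c : X,
      warr bsim (arr sim a b) (warr bsim (arr sim b c) (arr sim a c)) = ⊤ ∧
      arr sim (warr bsim a b) (arr sim (warr bsim b c) (warr bsim a c)) = ⊤) ∧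
    (∀ a : X, arr sim ⊤ a = a ∧ warr bsim ⊤ a = a) ∧
    (∀ a : X, arr sim a ⊤ = ⊤ ∧ warr bsim a ⊤ = ⊤) ∧
    (∀ a b : X, (a ≤ b ↔ arr sim a b = ⊤) ∧ (a ≤ b ↔ warr bsim a b = ⊤)) ∧
    (∀ a b : X, arr sim a b = ⊤ → arr sim b a = ⊤ → a = b) ∧
    (∀ a b c : X, arr sim b a ≤ arr sim (b ⊓ c) (a ⊓ c) ∧
      warr bsim b a ≤ warr bsim (b ⊓ c) (a ⊓ c)) := by
  have arr_top_iff (a b : X) : a ≤ b ↔ arr sim a b = ⊤ := by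
    refine ⟨fun h => by rw [arr, inf_eq_left.2 h, (F2 a).1], fun h => ?_⟩
    have key := (F6 a ⊤ (a ⊓ b)).1
    rw [arr] at h
    rw [(F3 a).1, (F3 (a ⊓ b)).1, h, (F3 (a ⊓ b)).2] at key
    exact key.trans inf_le_right
  have warr_top_iff (a b : X) : a ≤ b ↔ warr bsim a b = ⊤ := by
    refine ⟨fun h => by rw [warr, inf_eq_left.2 h, (F2 a).2], fun h => ?_⟩
    have key := (F6 ⊤ a (a ⊓ b)).2
    rw [warr] at h
    rw [(F3 a).2, (F3 (a ⊓ b)).2, h, (F3 (a ⊓ b)).1] at key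
    exact key.trans inf_le_right
  have inf_inf_eq (a b c : X) : b ⊓ c ⊓ (a ⊓ c) = b ⊓ a ⊓ c := (inf_inf_distrib_right b a c).symm
  refine ⟨fun a b c => ⟨?_, ?_⟩, fun a => ⟨?_, ?_⟩, fun a => ⟨?_, ?_⟩,
    fun a b => ⟨arr_top_iff a b, warr_top_iff a b⟩,
    fun a b hab hba => le_antisymm ((arr_top_iff a b).2 hab) ((arr_top_iff b a).2 hba),
    fun a b c => ⟨?_, ?_⟩⟩
  · rw [← warr_top_iff]
    -- Compare `b → c` and `a → c` through the common element `a ⊓ b ⊓ c`.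
    have hB : arr sim b c ≤ sim (a ⊓ b ⊓ c) (a ⊓ b) := by
      have h := (F5 (b ⊓ c) b a).1
      rwa [inf_comm (b ⊓ c) a, ← inf_assoc, inf_comm b a] at h
    have hC : sim (a ⊓ b ⊓ c) a ≤ arr sim a c :=
      (F4 _ (a ⊓ c) a (inf_le_inf_right c inf_le_left) inf_le_left).1
    calc arr sim a b
        ≤ bsim (sim (a ⊓ b ⊓ c) (a ⊓ b)) (sim (a ⊓ b ⊓ c) a) := (F6 _ _ _).1
      _ ≤ bsim (sim (a ⊓ b ⊓ c) (a ⊓ b) ⊓ arr sim b c)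
            (sim (a ⊓ b ⊓ c) a ⊓ arr sim b c) := (F5 _ _ _).2
      _ = bsim (arr sim b c) (arr sim b c ⊓ sim (a ⊓ b ⊓ c) a) := by
        rw [inf_eq_right.2 hB, inf_comm (arr sim b c)]
      _ ≤ warr bsim (arr sim b c) (arr sim a c) :=
        (F4 _ _ _ (inf_le_inf_left _ hC) inf_le_left).2.2.1
  · rw [← arr_top_iff]
    have hB : warr bsim b c ≤ bsim (a ⊓ b) (a ⊓ b ⊓ c) := by
      have h := (F5 b (b ⊓ c) a).2
      rwa [inf_comm (b ⊓ c) a, ← inf_assoc, inf_comm b a] at h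
    have hC : bsim a (a ⊓ b ⊓ c) ≤ warr bsim a c :=
      (F4 _ (a ⊓ c) a (inf_le_inf_right c inf_le_left) inf_le_left).2.2.1
    calc warr bsim a b
        ≤ sim (bsim a (a ⊓ b ⊓ c)) (bsim (a ⊓ b) (a ⊓ b ⊓ c)) := (F6 _ _ _).2
      _ ≤ sim (bsim a (a ⊓ b ⊓ c) ⊓ warr bsim b c)
            (bsim (a ⊓ b) (a ⊓ b ⊓ c) ⊓ warr bsim b c) := (F5 _ _ _).1
      _ = sim (warr bsim b c ⊓ bsim a (a ⊓ b ⊓ c)) (warr bsim b c) := by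
        rw [inf_eq_right.2 hB, inf_comm (warr bsim b c)]
      _ ≤ arr sim (warr bsim b c) (warr bsim a c) :=
        (F4 _ _ _ (inf_le_inf_left _ hC) inf_le_left).1
  · rw [arr, top_inf_eq, (F3 a).1]
  · rw [warr, top_inf_eq, (F3 a).2]
  · exact (arr_top_iff a ⊤).1 le_top
  · exact (warr_top_iff a ⊤).1 le_top
  · rw [arr, arr, inf_inf_eq]
    exact (F5 _ _ _).1
  · rw [warr, warr, inf_inf_eq]
    exact (F5 _ _ _).2
end

section
/- Let (X; →, ⇝, ∧, 1) be a pseudo BCK-meet-semilattice satisfying condition (xii): b → a ≤ (b ∧ c) → (a ∧ c) and b ⇝ a ≤ (b ∧ c) ⇝ (a ∧ c) for all a, b, c ∈ X. Define a ∼ b := b → a and a ∽ b := a ⇝ b. Then (X; ∼, ∽, ∧, 1) is a pseudo equality algebra, i.e., axioms (F2)–(F7) hold. -/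
section PseudoBCK

variable {X : Type*} [PartialOrder X] [OrderTop X] {arrow squig : X → X → X}

/-- Suffixing makes an implication antitone in its first argument. -/
theorem arrow_antitone_left (harrow : ∀ a b : X, a ≤ b ↔ arrow a b = ⊤)
    (hsquig : ∀ a b : X, a ≤ b ↔ squig a b = ⊤)
    (hsuffix : ∀ a b c : X, arrow a b ≤ squig (arrow b c) (arrow a c))
    {a b : X} (hab : a ≤ b) (c : X) : arrow b c ≤ arrow a c := by
  have h := hsuffix a b c
  rwa [(harrow a b).1 hab, top_le_iff, ← hsquig] at h

/-- Suffixing makes an implication monotone in its second argument. -/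
theorem arrow_monotone_right (harrow : ∀ a b : X, a ≤ b ↔ arrow a b = ⊤)
    (htop : ∀ a : X, squig ⊤ a = a)
    (hsuffix : ∀ a b c : X, arrow a b ≤ squig (arrow b c) (arrow a c))
    {a b : X} (hab : a ≤ b) (c : X) : arrow c a ≤ arrow c b := by
  have h := hsuffix c a b
  rwa [(harrow a b).1 hab, htop] at h

/-- One half of the Galois connection between the two implications. -/
theorem le_squig_of_le_arrow (harrow : ∀ a b : X, a ≤ b ↔ arrow a b = ⊤)
    (hsquig : ∀ a b : X, a ≤ b ↔ squig a b = ⊤)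
    (htop : ∀ a : X, arrow ⊤ a = a)
    (hsuffix : ∀ a b c : X, arrow a b ≤ squig (arrow b c) (arrow a c))
    (hsuffix' : ∀ a b c : X, squig a b ≤ arrow (squig b c) (squig a c))
    {x y z : X} (h : x ≤ arrow y z) : y ≤ squig x z := by
  have hy := hsuffix ⊤ y z
  rw [htop, htop] at hy
  exact hy.trans (arrow_antitone_left hsquig harrow hsuffix' h z)

end PseudoBCK

/-- Theorem 4.2 (ii): a pseudo BCK-meet-semilattice satisfying condition (xii), with
`a ∼ b := b → a` and `a ∽ b := a ⇝ b`, is a pseudo equality algebra ((F2)–(F7) hold). -/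
theorem pseudoBCK_to_pseudoEquality (X : Type*) [SemilatticeInf X] [OrderTop X]
    (arrow squig : X → X → X)
    (hord : ∀ a b : X, (a ≤ b ↔ arrow a b = ⊤) ∧ (a ≤ b ↔ squig a b = ⊤))
    (PBCK1 : ∀ a b c : X,
      squig (arrow a b) (squig (arrow b c) (arrow a c)) = ⊤ ∧
      arrow (squig a b) (arrow (squig b c) (squig a c)) = ⊤)
    (PBCK2 : ∀ a : X, arrow ⊤ a = a ∧ squig ⊤ a = a)
    (PBCK3 : ∀ a : X, arrow a ⊤ = ⊤ ∧ squig a ⊤ = ⊤)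
    (hxii : ∀ a b c : X, arrow b a ≤ arrow (b ⊓ c) (a ⊓ c) ∧ squig b a ≤ squig (b ⊓ c) (a ⊓ c)) :
    (∀ a : X, arrow a a = ⊤ ∧ squig a a = ⊤) ∧
    (∀ a : X, arrow ⊤ a = a ∧ squig ⊤ a = a) ∧
    (∀ a b c : X, a ≤ b → b ≤ c →
      arrow c a ≤ arrow c b ∧ arrow c a ≤ arrow b a ∧
      squig c a ≤ squig c b ∧ squig c a ≤ squig b a) ∧
    (∀ a b c : X, arrow b a ≤ arrow (b ⊓ c) (a ⊓ c) ∧ squig a b ≤ squig (a ⊓ c) (b ⊓ c)) ∧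
    (∀ a b c : X, arrow b a ≤ squig (arrow a c) (arrow b c) ∧
      squig a b ≤ arrow (squig b c) (squig a c)) ∧
    (∀ a b c : X, arrow b a ≤ arrow (arrow c b) (arrow c a) ∧
      squig a b ≤ squig (squig c a) (squig c b)) := by
  have harrow a b := (hord a b).1
  have hsquig a b := (hord a b).2
  have arrow_top a := (PBCK2 a).1
  have squig_top a := (PBCK2 a).2
  have hsuffix : ∀ a b c : X, arrow a b ≤ squig (arrow b c) (arrow a c) :=
    fun a b c => (hsquig _ _).2 (PBCK1 a b c).1
  have hsuffix' : ∀ a b c : X, squig a b ≤ arrow (squig b c) (squig a c) :=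
    fun a b c => (harrow _ _).2 (PBCK1 a b c).2
  refine ⟨fun a => ⟨(harrow a a).1 le_rfl, (hsquig a a).1 le_rfl⟩, PBCK2, ?_,
    fun a b c => ⟨(hxii a b c).1, (hxii b a c).2⟩,
    fun a b c => ⟨hsuffix b a c, hsuffix' a b c⟩, ?_⟩
  · intro a b c hab hbc
    exact ⟨arrow_monotone_right harrow squig_top hsuffix hab c,
      arrow_antitone_left harrow hsquig hsuffix hbc a,
      arrow_monotone_right hsquig arrow_top hsuffix' hab c,
      arrow_antitone_left hsquig harrow hsuffix' hbc a⟩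
  · intro a b c
    exact ⟨le_squig_of_le_arrow hsquig harrow squig_top hsuffix' hsuffix (hsuffix c b a),
      le_squig_of_le_arrow harrow hsquig arrow_top hsuffix hsuffix' (hsuffix' c a b)⟩
end

section
/- Let (X; →, ⇝, ∧, 1) be a pseudo BCK-meet-semilattice satisfying condition (xii): b → a ≤ (b ∧ c) → (a ∧ c) and b ⇝ a ≤ (b ∧ c) ⇝ (a ∧ c) for all a, b, c ∈ X. Define a ∼ b := b → a and a ∽ b := a ⇝ b, and then the derived operations a →' b := (a ∧ b) ∼ a and a ⇝' b := a ∽ (a ∧ b). Then →' = → and ⇝' = ⇝ (i.e., F(G(X)) = X, where G maps a pseudo BCK-meet-semilattice with (xii) to its induced pseudo equality algebra and F maps a pseudo equality algebra to its induced pseudo BCK-meet-semilattice). -/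
/-- Theorem 4.4 (ii): for a pseudo BCK-meet-semilattice satisfying condition (xii), the
implications derived from the induced pseudo equality algebra coincide with the original
ones, i.e. `F(G(X)) = X`. -/
theorem pseudoBCK_FG_identity (X : Type*) [SemilatticeInf X] [OrderTop X]
    (arrow squig : X → X → X)
    (hord : ∀ a b : X, (a ≤ b ↔ arrow a b = ⊤) ∧ (a ≤ b ↔ squig a b = ⊤))
    (PBCK1 : ∀ a b c : X,
      squig (arrow a b) (squig (arrow b c) (arrow a c)) = ⊤ ∧
      arrow (squig a b) (arrow (squig b c) (squig a c)) = ⊤)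
    (PBCK2 : ∀ a : X, arrow ⊤ a = a ∧ squig ⊤ a = a)
    (PBCK3 : ∀ a : X, arrow a ⊤ = ⊤ ∧ squig a ⊤ = ⊤)
    (hxii : ∀ a b c : X, arrow b a ≤ arrow (b ⊓ c) (a ⊓ c) ∧ squig b a ≤ squig (b ⊓ c) (a ⊓ c)) :
    ∀ a b : X, arrow a (a ⊓ b) = arrow a b ∧ squig a (a ⊓ b) = squig a b := by
  have arrow_mono : ∀ a b c : X, b ≤ c → arrow a b ≤ arrow a c := fun a b c hbc => by
    have h := (PBCK1 a b c).1
    rw [(hord b c).1.mp hbc, (PBCK2 _).2] at h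
    exact (hord _ _).2.mpr h
  have squig_mono : ∀ a b c : X, b ≤ c → squig a b ≤ squig a c := fun a b c hbc => by
    have h := (PBCK1 a b c).2
    rw [(hord b c).2.mp hbc, (PBCK2 _).1] at h
    exact (hord _ _).1.mpr h
  intro a b
  have h := hxii b a a
  rw [inf_idem, inf_comm b a] at h
  exact ⟨(arrow_mono a _ b inf_le_right).antisymm h.1,
    (squig_mono a _ b inf_le_right).antisymm h.2⟩
end

section
/- Let (X; ∼, ∽, ∧, 1) be a pseudo equality algebra and let F ⊆ X with 1 ∈ F. Then: (1) if F is a (→,⇝)-deductive system, then F is an upset (a ∈ F and a ≤ b imply b ∈ F); (2) F is a (→,⇝)-deductive system if and only if for all a, b: a ∈ F and a ⇝ b ∈ F imply b ∈ F; (3) F is a (∼,∽)-deductive system if and only if F is an upset such that for all a, b: a ∈ F and a ∽ b ∈ F imply b ∈ F. -/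
/-- Lemma 6.1: basic facts about `(→,⇝)`- and `(∼,∽)`-deductive systems of a pseudo
equality algebra. -/
theorem pseudoEquality_deductive_lemma (X : Type*) [SemilatticeInf X] [OrderTop X]
    (sim bsim : X → X → X)
    (F2 : ∀ a : X, sim a a = ⊤ ∧ bsim a a = ⊤)
    (F3 : ∀ a : X, sim a ⊤ = a ∧ bsim ⊤ a = a)
    (F4 : ∀ a b c : X, a ≤ b → b ≤ c →
      sim a c ≤ sim b c ∧ sim a c ≤ sim a b ∧ bsim c a ≤ bsim c b ∧ bsim c a ≤ bsim b a)
    (F5 : ∀ a b c : X, sim a b ≤ sim (a ⊓ c) (b ⊓ c) ∧ bsim a b ≤ bsim (a ⊓ c) (b ⊓ c))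
    (F6 : ∀ a b c : X, sim a b ≤ bsim (sim c a) (sim c b) ∧ bsim a b ≤ sim (bsim a c) (bsim b c))
    (F7 : ∀ a b c : X, sim a b ≤ sim (sim a c) (sim b c) ∧ bsim a b ≤ bsim (bsim c a) (bsim c b))
    (F : Set X) (h1 : (⊤ : X) ∈ F) :
    ((∀ a b : X, a ∈ F → arr sim a b ∈ F → b ∈ F) →
      ∀ a b : X, a ∈ F → a ≤ b → b ∈ F) ∧
    ((∀ a b : X, a ∈ F → arr sim a b ∈ F → b ∈ F) ↔
      (∀ a b : X, a ∈ F → warr bsim a b ∈ F → b ∈ F)) ∧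
    (((∀ a b : X, a ∈ F → a ≤ b → b ∈ F) ∧ (∀ a b : X, a ∈ F → sim b a ∈ F → b ∈ F)) ↔
      ((∀ a b : X, a ∈ F → a ≤ b → b ∈ F) ∧ (∀ a b : X, a ∈ F → bsim a b ∈ F → b ∈ F))) := by
  have le_sim (a d : X) : a ≤ sim d (bsim a d) := by
    simpa only [F3] using (F6 ⊤ a d).2
  have le_bsim (a d : X) : a ≤ bsim (sim d a) d := by
    simpa only [F3] using (F6 a ⊤ d).1
  have le_sim_of_le (a d : X) (h : d ≤ a) : d ≤ sim d a := by
    simpa only [F3] using (F4 d a ⊤ h le_top).2.1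
  have le_bsim_of_le (a d : X) (h : d ≤ a) : d ≤ bsim a d := by
    simpa only [F3] using (F4 d a ⊤ h le_top).2.2.2
  have upset_of_arr (H : ∀ a b : X, a ∈ F → arr sim a b ∈ F → b ∈ F) (a b : X)
      (ha : a ∈ F) (hab : a ≤ b) : b ∈ F := by
    refine H a b ha ?_
    rwa [arr, inf_eq_left.2 hab, (F2 a).1]
  have upset_of_warr (H : ∀ a b : X, a ∈ F → warr bsim a b ∈ F → b ∈ F) (a b : X)
      (ha : a ∈ F) (hab : a ≤ b) : b ∈ F := by
    refine H a b ha ?_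
    rwa [warr, inf_eq_left.2 hab, (F2 a).2]
  refine ⟨upset_of_arr, ⟨fun H a b ha hab => ?_, fun H a b ha hab => ?_⟩,
    ⟨fun ⟨up, H⟩ => ⟨up, fun a b ha hab => H _ b hab (up _ _ ha (le_sim a b))⟩,
      fun ⟨up, H⟩ => ⟨up, fun a b ha hab => H _ b hab (up _ _ ha (le_bsim a b))⟩⟩⟩
  · refine upset_of_arr H (a ⊓ b) b (H _ _ hab ?_) inf_le_right
    rw [arr, warr, inf_eq_right.2 (le_bsim_of_le a _ inf_le_left)]
    exact upset_of_arr H _ _ ha (le_sim a _)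
  · refine upset_of_warr H (a ⊓ b) b (H _ _ hab ?_) inf_le_right
    rw [warr, arr, inf_eq_right.2 (le_sim_of_le a _ inf_le_left)]
    exact upset_of_warr H _ _ ha (le_bsim a _)
end

section
/- Let (X; ∼, ∽, ∧, 1) be a pseudo equality algebra and let F ⊆ X be a subset with 1 ∈ F. Then F is a (∼,∽)-deductive system if and only if F is a (→,⇝)-deductive system. -/
/-- Proposition 5.2: `(∼,∽)`-deductive systems and `(→,⇝)`-deductive systems of a pseudo
equality algebra coincide. -/
theorem pseudoEquality_deductive_equiv (X : Type*) [SemilatticeInf X] [OrderTop X]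
    (sim bsim : X → X → X)
    (F2 : ∀ a : X, sim a a = ⊤ ∧ bsim a a = ⊤)
    (F3 : ∀ a : X, sim a ⊤ = a ∧ bsim ⊤ a = a)
    (F4 : ∀ a b c : X, a ≤ b → b ≤ c →
      sim a c ≤ sim b c ∧ sim a c ≤ sim a b ∧ bsim c a ≤ bsim c b ∧ bsim c a ≤ bsim b a)
    (F5 : ∀ a b c : X, sim a b ≤ sim (a ⊓ c) (b ⊓ c) ∧ bsim a b ≤ bsim (a ⊓ c) (b ⊓ c))
    (F6 : ∀ a b c : X, sim a b ≤ bsim (sim c a) (sim c b) ∧ bsim a b ≤ sim (bsim a c) (bsim b c))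
    (F7 : ∀ a b c : X, sim a b ≤ sim (sim a c) (sim b c) ∧ bsim a b ≤ bsim (bsim c a) (bsim c b))
    (F : Set X) (h1 : (⊤ : X) ∈ F) :
    ((∀ a b : X, a ∈ F → a ≤ b → b ∈ F) ∧ (∀ a b : X, a ∈ F → sim b a ∈ F → b ∈ F)) ↔
      (∀ a b : X, a ∈ F → arr sim a b ∈ F → b ∈ F) := by
  constructor
  · rintro ⟨upset, detach⟩ a b ha hab
    exact upset (a ⊓ b) b (detach a (a ⊓ b) ha hab) inf_le_right
  · intro detach
    have upset : ∀ a b : X, a ∈ F → a ≤ b → b ∈ F := fun a b ha hab =>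
      detach a b ha (by rwa [arr, inf_eq_left.mpr hab, (F2 a).1])
    refine ⟨upset, fun a b ha hba => detach a b ha (upset _ _ hba ?_)⟩
    simpa [arr, inf_comm] using (F5 b a a).1
end

section
/- Let F be a deductive system of a pseudo equality algebra (X; ∼, ∽, ∧, 1) and let a, b ∈ F. Then a → b ∈ F, a ⇝ b ∈ F, and a ∧ b ∈ F. -/
/-- Proposition on closure of deductive systems of a pseudo equality algebra under
`→`, `⇝` and `∧`. -/
theorem pseudoEquality_deductive_closed_under_ops (X : Type*) [SemilatticeInf X] [OrderTop X]
    (sim bsim : X → X → X)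
    (F2 : ∀ a : X, sim a a = ⊤ ∧ bsim a a = ⊤)
    (F3 : ∀ a : X, sim a ⊤ = a ∧ bsim ⊤ a = a)
    (F4 : ∀ a b c : X, a ≤ b → b ≤ c →
      sim a c ≤ sim b c ∧ sim a c ≤ sim a b ∧ bsim c a ≤ bsim c b ∧ bsim c a ≤ bsim b a)
    (F5 : ∀ a b c : X, sim a b ≤ sim (a ⊓ c) (b ⊓ c) ∧ bsim a b ≤ bsim (a ⊓ c) (b ⊓ c))
    (F6 : ∀ a b c : X, sim a b ≤ bsim (sim c a) (sim c b) ∧ bsim a b ≤ sim (bsim a c) (bsim b c))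
    (F7 : ∀ a b c : X, sim a b ≤ sim (sim a c) (sim b c) ∧ bsim a b ≤ bsim (bsim c a) (bsim c b))
    (F : Set X) (h1 : (⊤ : X) ∈ F)
    (hup : ∀ a b : X, a ∈ F → a ≤ b → b ∈ F)
    (hded : ∀ a b : X, a ∈ F → sim b a ∈ F → b ∈ F) :
    ∀ a b : X, a ∈ F → b ∈ F → arr sim a b ∈ F ∧ warr bsim a b ∈ F ∧ a ⊓ b ∈ F := by
  intro a b ha hb
  have harr : arr sim a b ∈ F := by
    refine hup b _ hb ?_
    simpa [arr, (F3 b).1, inf_comm] using (F5 b ⊤ a).1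
  have hwarr : warr bsim a b ∈ F := by
    refine hup b _ hb ?_
    simpa [warr, (F3 b).2, inf_comm] using (F5 ⊤ b a).2
  exact ⟨harr, hwarr, hded a (a ⊓ b) ha harr⟩
end

section
/- Let F be a deductive system of a pseudo equality algebra (X; ∼, ∽, ∧, 1). Then F is closed (i.e., x ∼ y ∈ F and x ∽ y ∈ F for all x, y ∈ F) if and only if 1 ∼ x ∈ F and x ∽ 1 ∈ F for all x ∈ F. -/
/-- A deductive system `F` of a pseudo equality algebra is closed iff `1 ∼ x, x ∽ 1 ∈ F`
for all `x ∈ F`. -/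
theorem pseudoEquality_closed_iff (X : Type*) [SemilatticeInf X] [OrderTop X]
    (sim bsim : X → X → X)
    (F2 : ∀ a : X, sim a a = ⊤ ∧ bsim a a = ⊤)
    (F3 : ∀ a : X, sim a ⊤ = a ∧ bsim ⊤ a = a)
    (F4 : ∀ a b c : X, a ≤ b → b ≤ c →
      sim a c ≤ sim b c ∧ sim a c ≤ sim a b ∧ bsim c a ≤ bsim c b ∧ bsim c a ≤ bsim b a)
    (F5 : ∀ a b c : X, sim a b ≤ sim (a ⊓ c) (b ⊓ c) ∧ bsim a b ≤ bsim (a ⊓ c) (b ⊓ c))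
    (F6 : ∀ a b c : X, sim a b ≤ bsim (sim c a) (sim c b) ∧ bsim a b ≤ sim (bsim a c) (bsim b c))
    (F7 : ∀ a b c : X, sim a b ≤ sim (sim a c) (sim b c) ∧ bsim a b ≤ bsim (bsim c a) (bsim c b))
    (F : Set X) (h1 : (⊤ : X) ∈ F)
    (hup : ∀ a b : X, a ∈ F → a ≤ b → b ∈ F)
    (hded : ∀ a b : X, a ∈ F → sim b a ∈ F → b ∈ F) :
    (∀ x ∈ F, ∀ y ∈ F, sim x y ∈ F ∧ bsim x y ∈ F) ↔
      (∀ x ∈ F, sim ⊤ x ∈ F ∧ bsim x ⊤ ∈ F) := by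
  refine ⟨fun h x hx => ⟨(h ⊤ h1 x hx).1, (h x hx ⊤ h1).2⟩, fun h x hx y hy => ⟨?_, ?_⟩⟩
  · refine hded (sim ⊤ y) _ (h y hy).1 (hup x _ hx ?_)
    simpa only [(F3 x).1] using (F7 x ⊤ y).1
  · refine hded y _ hy (hup _ _ (h x hx).2 ?_)
    simpa only [(F3 y).2] using (F6 x ⊤ y).2
end

section
/- Let θ be a congruence relation on a pseudo equality algebra (X; ∼, ∽, ∧, 1). Then F_θ = {x ∈ X : (x, 1) ∈ θ} is a closed normal deductive system of X. -/
/-- Proposition 5.4: if `θ` is a congruence on a pseudo equality algebra, then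
`F_θ = {x : (x,1) ∈ θ}` is a closed normal deductive system. -/
theorem pseudoEquality_congruence_class_of_one (X : Type*) [SemilatticeInf X] [OrderTop X]
    (sim bsim : X → X → X)
    (F2 : ∀ a : X, sim a a = ⊤ ∧ bsim a a = ⊤)
    (F3 : ∀ a : X, sim a ⊤ = a ∧ bsim ⊤ a = a)
    (F4 : ∀ a b c : X, a ≤ b → b ≤ c →
      sim a c ≤ sim b c ∧ sim a c ≤ sim a b ∧ bsim c a ≤ bsim c b ∧ bsim c a ≤ bsim b a)
    (F5 : ∀ a b c : X, sim a b ≤ sim (a ⊓ c) (b ⊓ c) ∧ bsim a b ≤ bsim (a ⊓ c) (b ⊓ c))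
    (F6 : ∀ a b c : X, sim a b ≤ bsim (sim c a) (sim c b) ∧ bsim a b ≤ sim (bsim a c) (bsim b c))
    (F7 : ∀ a b c : X, sim a b ≤ sim (sim a c) (sim b c) ∧ bsim a b ≤ bsim (bsim c a) (bsim c b))
    (θ : X → X → Prop) (hequiv : Equivalence θ)
    (hcong : ∀ a b x y : X, θ a b → θ x y →
      θ (sim a x) (sim b y) ∧ θ (bsim a x) (bsim b y) ∧ θ (a ⊓ x) (b ⊓ y)) :
    ((⊤ : X) ∈ {x : X | θ x ⊤}) ∧
    (∀ a b : X, a ∈ {x : X | θ x ⊤} → a ≤ b → b ∈ {x : X | θ x ⊤}) ∧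
    (∀ a b : X, a ∈ {x : X | θ x ⊤} → sim b a ∈ {x : X | θ x ⊤} → b ∈ {x : X | θ x ⊤}) ∧
    (∀ x ∈ {x : X | θ x ⊤}, ∀ y ∈ {x : X | θ x ⊤},
      sim x y ∈ {x : X | θ x ⊤} ∧ bsim x y ∈ {x : X | θ x ⊤}) ∧
    (∀ x y : X, (sim x y ∈ {x : X | θ x ⊤} ∧ sim y x ∈ {x : X | θ x ⊤}) ↔
      (bsim x y ∈ {x : X | θ x ⊤} ∧ bsim y x ∈ {x : X | θ x ⊤})) := by
  have le_bsim_sim (a c : X) : a ≤ bsim (sim c a) c := by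
    simpa only [(F3 _).1] using (F6 a ⊤ c).1
  have le_sim_bsim (b c : X) : b ≤ sim c (bsim b c) := by
    simpa only [(F3 _).2] using (F6 ⊤ b c).2
  have rel_inf_of_sim {x y : X} (h : θ (sim x y) ⊤) : θ y (y ⊓ x) := by
    have hx := (hcong _ _ x x h (hequiv.refl x)).2.1
    rw [(F3 x).2] at hx
    simpa only [inf_eq_left.mpr (le_bsim_sim y x)] using
      (hcong y y _ _ (hequiv.refl y) hx).2.2
  have rel_inf_of_bsim {x y : X} (h : θ (bsim x y) ⊤) : θ x (x ⊓ y) := by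
    have hy := (hcong y y _ _ (hequiv.refl y) h).1
    rw [(F3 y).1] at hy
    simpa only [inf_eq_left.mpr (le_sim_bsim x y)] using
      (hcong x x _ _ (hequiv.refl x) hy).2.2
  have sim_of_rel {x y : X} (h : θ x y) : θ (sim x y) ⊤ := by
    simpa only [(F2 _).1] using (hcong _ _ y y h (hequiv.refl y)).1
  have bsim_of_rel {x y : X} (h : θ x y) : θ (bsim x y) ⊤ := by
    simpa only [(F2 _).2] using (hcong _ _ y y h (hequiv.refl y)).2.1
  simp only [Set.mem_ofPred_eq]
  refine ⟨hequiv.refl ⊤, fun a b ha hab => ?_, fun a b ha hba => ?_, fun x hx y hy => ?_,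
    fun x y => ⟨fun ⟨hxy, hyx⟩ => ?_, fun ⟨hxy, hyx⟩ => ?_⟩⟩
  · have h := (hcong _ _ b b ha (hequiv.refl b)).2.2
    rw [inf_eq_left.mpr hab, top_inf_eq] at h
    exact hequiv.trans (hequiv.symm h) ha
  · have h := (hcong b b _ _ (hequiv.refl b) ha).1
    rw [(F3 b).1] at h
    exact hequiv.trans (hequiv.symm h) hba
  · have h : θ x y := hequiv.trans hx (hequiv.symm hy)
    exact ⟨sim_of_rel h, bsim_of_rel h⟩
  · have h : θ x y := hequiv.trans (rel_inf_of_sim hyx)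
      (inf_comm x y ▸ hequiv.symm (rel_inf_of_sim hxy))
    exact ⟨bsim_of_rel h, bsim_of_rel (hequiv.symm h)⟩
  · have h : θ x y := hequiv.trans (rel_inf_of_bsim hxy)
      (inf_comm x y ▸ hequiv.symm (rel_inf_of_bsim hyx))
    exact ⟨sim_of_rel h, sim_of_rel (hequiv.symm h)⟩
end

section
/- Let F be a deductive system of a pseudo equality algebra (X; ∼, ∽, ∧, 1) and define θ_F = {(x,y) ∈ X × X : x ∼ y ∈ F, y ∼ x ∈ F, x ∽ y ∈ F, y ∽ x ∈ F}. Then: (i) θ_F is an equivalence relation on X; (ii) if F is normal, then θ_F = {(x,y) : x ∼ y ∈ F and y ∼ x ∈ F} = {(x,y) : x ∽ y ∈ F and y ∽ x ∈ F} and θ_F is a congruence relation on X. -/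
/-- Proposition 5.5: for a deductive system `F` of a pseudo equality algebra, the relation
`θ_F` is an equivalence relation, and if `F` is normal then `θ_F` has the two simpler
descriptions and is a congruence. -/
theorem pseudoEquality_thetaF (X : Type*) [SemilatticeInf X] [OrderTop X]
    (sim bsim : X → X → X)
    (F2 : ∀ a : X, sim a a = ⊤ ∧ bsim a a = ⊤)
    (F3 : ∀ a : X, sim a ⊤ = a ∧ bsim ⊤ a = a)
    (F4 : ∀ a b c : X, a ≤ b → b ≤ c →
      sim a c ≤ sim b c ∧ sim a c ≤ sim a b ∧ bsim c a ≤ bsim c b ∧ bsim c a ≤ bsim b a)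
    (F5 : ∀ a b c : X, sim a b ≤ sim (a ⊓ c) (b ⊓ c) ∧ bsim a b ≤ bsim (a ⊓ c) (b ⊓ c))
    (F6 : ∀ a b c : X, sim a b ≤ bsim (sim c a) (sim c b) ∧ bsim a b ≤ sim (bsim a c) (bsim b c))
    (F7 : ∀ a b c : X, sim a b ≤ sim (sim a c) (sim b c) ∧ bsim a b ≤ bsim (bsim c a) (bsim c b))
    (F : Set X) (h1 : (⊤ : X) ∈ F)
    (hup : ∀ a b : X, a ∈ F → a ≤ b → b ∈ F)
    (hded : ∀ a b : X, a ∈ F → sim b a ∈ F → b ∈ F) :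
    Equivalence (fun x y : X => sim x y ∈ F ∧ sim y x ∈ F ∧ bsim x y ∈ F ∧ bsim y x ∈ F) ∧
    ((∀ x y : X, (sim x y ∈ F ∧ sim y x ∈ F) ↔ (bsim x y ∈ F ∧ bsim y x ∈ F)) →
      (∀ x y : X, (sim x y ∈ F ∧ sim y x ∈ F ∧ bsim x y ∈ F ∧ bsim y x ∈ F) ↔
        (sim x y ∈ F ∧ sim y x ∈ F)) ∧
      (∀ x y : X, (sim x y ∈ F ∧ sim y x ∈ F ∧ bsim x y ∈ F ∧ bsim y x ∈ F) ↔
        (bsim x y ∈ F ∧ bsim y x ∈ F)) ∧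
      (∀ a b x y : X,
        (sim a b ∈ F ∧ sim b a ∈ F ∧ bsim a b ∈ F ∧ bsim b a ∈ F) →
        (sim x y ∈ F ∧ sim y x ∈ F ∧ bsim x y ∈ F ∧ bsim y x ∈ F) →
        (sim (sim a x) (sim b y) ∈ F ∧ sim (sim b y) (sim a x) ∈ F ∧
          bsim (sim a x) (sim b y) ∈ F ∧ bsim (sim b y) (sim a x) ∈ F) ∧
        (sim (bsim a x) (bsim b y) ∈ F ∧ sim (bsim b y) (bsim a x) ∈ F ∧
          bsim (bsim a x) (bsim b y) ∈ F ∧ bsim (bsim b y) (bsim a x) ∈ F) ∧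
        (sim (a ⊓ x) (b ⊓ y) ∈ F ∧ sim (b ⊓ y) (a ⊓ x) ∈ F ∧
          bsim (a ⊓ x) (b ⊓ y) ∈ F ∧ bsim (b ⊓ y) (a ⊓ x) ∈ F))) := by
  have sim_trans : ∀ {x y z : X}, sim x y ∈ F → sim y z ∈ F → sim x z ∈ F :=
    fun {x y z} hxy hyz => hded _ _ hyz (hup _ _ hxy (F7 x y z).1)
  have bsim_trans : ∀ {x y z : X}, bsim x y ∈ F → bsim y z ∈ F → bsim x z ∈ F :=
    fun {x y z} hxy hyz => hded _ _ hyz (hup _ _ hxy (F6 x y z).2)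
  refine ⟨⟨fun x => ?_, ?_, ?_⟩, fun hnormal => ⟨fun x y => ?_, fun x y => ?_, ?_⟩⟩
  · simp only [F2, h1, and_self]
  · rintro x y ⟨h, h', k, k'⟩
    exact ⟨h', h, k', k⟩
  · rintro x y z ⟨h, h', k, k'⟩ ⟨l, l', m, m'⟩
    exact ⟨sim_trans h l, sim_trans l' h', bsim_trans k m, bsim_trans m' k'⟩
  · have := hnormal x y
    tauto
  · have := hnormal x y
    tauto
  · rintro a b x y ⟨hab, hba, kab, kba⟩ ⟨hxy, hyx, kxy, kyx⟩
    have of_sim : ∀ {u v : X}, sim u v ∈ F → sim v u ∈ F →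
        sim u v ∈ F ∧ sim v u ∈ F ∧ bsim u v ∈ F ∧ bsim v u ∈ F :=
      fun {u v} h h' => ⟨h, h', (hnormal u v).1 ⟨h, h'⟩⟩
    refine ⟨?_, ?_, ?_⟩
    · obtain ⟨h, h'⟩ := (hnormal (sim b x) (sim b y)).2
        ⟨hup _ _ hxy (F6 x y b).1, hup _ _ hyx (F6 y x b).1⟩
      exact of_sim (sim_trans (hup _ _ hab (F7 a b x).1) h)
        (sim_trans h' (hup _ _ hba (F7 b a x).1))
    · obtain ⟨h, h'⟩ := (hnormal (bsim b x) (bsim b y)).2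
        ⟨hup _ _ kxy (F7 x y b).2, hup _ _ kyx (F7 y x b).2⟩
      exact of_sim (sim_trans (hup _ _ kab (F6 a b x).2) h)
        (sim_trans h' (hup _ _ kba (F6 b a x).2))
    · have h := hup _ _ hxy (F5 x y b).1
      have h' := hup _ _ hyx (F5 y x b).1
      rw [inf_comm x b, inf_comm y b] at h h'
      exact of_sim (sim_trans (hup _ _ hab (F5 a b x).1) h)
        (sim_trans h' (hup _ _ hba (F5 b a x).1))
end

section
/- Let (X; ∼, ∽, ∧, 1) be a pseudo equality algebra. The map θ ↦ F_θ := {x ∈ X : (x,1) ∈ θ} is a bijection from the set of congruence relations on X onto the set of normal closed deductive systems of X; its inverse is F ↦ θ_F := {(x,y) : x ∼ y ∈ F, y ∼ x ∈ F, x ∽ y ∈ F, y ∽ x ∈ F}. In particular, θ_{F_θ} = θ for every congruence θ and F_{θ_F} = F for every normal closed deductive system F. -/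
/-- Theorem 5.6: the map `θ ↦ F_θ = {x : (x,1) ∈ θ}` is a bijection between the congruences
of a pseudo equality algebra and its normal closed deductive systems, with inverse
`F ↦ θ_F`. -/
theorem pseudoEquality_congruence_bijection (X : Type*) [SemilatticeInf X] [OrderTop X]
    (sim bsim : X → X → X)
    (F2 : ∀ a : X, sim a a = ⊤ ∧ bsim a a = ⊤)
    (F3 : ∀ a : X, sim a ⊤ = a ∧ bsim ⊤ a = a)
    (F4 : ∀ a b c : X, a ≤ b → b ≤ c →
      sim a c ≤ sim b c ∧ sim a c ≤ sim a b ∧ bsim c a ≤ bsim c b ∧ bsim c a ≤ bsim b a)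
    (F5 : ∀ a b c : X, sim a b ≤ sim (a ⊓ c) (b ⊓ c) ∧ bsim a b ≤ bsim (a ⊓ c) (b ⊓ c))
    (F6 : ∀ a b c : X, sim a b ≤ bsim (sim c a) (sim c b) ∧ bsim a b ≤ sim (bsim a c) (bsim b c))
    (F7 : ∀ a b c : X, sim a b ≤ sim (sim a c) (sim b c) ∧ bsim a b ≤ bsim (bsim c a) (bsim c b)) :
    letI isCon : (X → X → Prop) → Prop := fun θ =>
      Equivalence θ ∧ ∀ a b x y : X, θ a b → θ x y →
        θ (sim a x) (sim b y) ∧ θ (bsim a x) (bsim b y) ∧ θ (a ⊓ x) (b ⊓ y)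
    letI isNCDS : Set X → Prop := fun F =>
      (⊤ : X) ∈ F ∧ (∀ a b : X, a ∈ F → a ≤ b → b ∈ F) ∧
      (∀ a b : X, a ∈ F → sim b a ∈ F → b ∈ F) ∧
      (∀ x ∈ F, ∀ y ∈ F, sim x y ∈ F ∧ bsim x y ∈ F) ∧
      (∀ x y : X, (sim x y ∈ F ∧ sim y x ∈ F) ↔ (bsim x y ∈ F ∧ bsim y x ∈ F))
    Set.BijOn (fun θ : X → X → Prop => {x : X | θ x ⊤}) {θ | isCon θ} {F | isNCDS F} ∧
    (∀ θ : X → X → Prop, isCon θ →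
      (fun x y : X => sim x y ∈ {x : X | θ x ⊤} ∧ sim y x ∈ {x : X | θ x ⊤} ∧
        bsim x y ∈ {x : X | θ x ⊤} ∧ bsim y x ∈ {x : X | θ x ⊤}) = θ) ∧
    (∀ F : Set X, isNCDS F →
      {x : X | sim x ⊤ ∈ F ∧ sim ⊤ x ∈ F ∧ bsim x ⊤ ∈ F ∧ bsim ⊤ x ∈ F} = F) := by
  let isCon : (X → X → Prop) → Prop := fun θ =>
    Equivalence θ ∧ ∀ a b x y : X, θ a b → θ x y →
      θ (sim a x) (sim b y) ∧ θ (bsim a x) (bsim b y) ∧ θ (a ⊓ x) (b ⊓ y)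
  let isNCDS : Set X → Prop := fun F =>
    (⊤ : X) ∈ F ∧ (∀ a b : X, a ∈ F → a ≤ b → b ∈ F) ∧
    (∀ a b : X, a ∈ F → sim b a ∈ F → b ∈ F) ∧
    (∀ x ∈ F, ∀ y ∈ F, sim x y ∈ F ∧ bsim x y ∈ F) ∧
    (∀ x y : X, (sim x y ∈ F ∧ sim y x ∈ F) ↔ (bsim x y ∈ F ∧ bsim y x ∈ F))
  -- In the quotient by a congruence, `x ∼ y = 1` forces `y ≤ x`.
  have rel_inf_of_sim : ∀ θ, isCon θ → ∀ x y, θ (sim x y) ⊤ → θ y (x ⊓ y) := by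
    rintro θ ⟨e, c⟩ x y h
    have hle : y ≤ bsim (sim x y) x := by
      simpa only [(F3 _).1] using (F6 y ⊤ x).1
    have hrel := (c _ _ _ _ (c _ _ _ _ h (e.refl x)).2.1 (e.refl y)).2.2
    rwa [(F3 x).2, inf_eq_right.mpr hle] at hrel
  have rel_of_sim : ∀ θ, isCon θ → ∀ x y, θ (sim x y) ⊤ → θ (sim y x) ⊤ → θ x y := by
    intro θ hθ x y hxy hyx
    have hy := rel_inf_of_sim θ hθ x y hxy
    have hx := rel_inf_of_sim θ hθ y x hyx
    rw [inf_comm] at hx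
    exact hθ.1.trans hx (hθ.1.symm hy)
  have rel_inf_of_bsim : ∀ θ, isCon θ → ∀ x y, θ (bsim x y) ⊤ → θ x (y ⊓ x) := by
    rintro θ ⟨e, c⟩ x y h
    have hle : x ≤ sim y (bsim x y) := by
      simpa only [(F3 _).2] using (F6 ⊤ x y).2
    have hrel := (c _ _ _ _ (c _ _ _ _ (e.refl y) h).1 (e.refl x)).2.2
    rwa [(F3 y).1, inf_eq_right.mpr hle] at hrel
  have rel_of_bsim : ∀ θ, isCon θ → ∀ x y, θ (bsim x y) ⊤ → θ (bsim y x) ⊤ → θ x y := by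
    intro θ hθ x y hxy hyx
    have hx := rel_inf_of_bsim θ hθ x y hxy
    have hy := rel_inf_of_bsim θ hθ y x hyx
    rw [inf_comm] at hy
    exact hθ.1.trans hx (hθ.1.symm hy)
  have sim_of_rel : ∀ θ, isCon θ → ∀ x y, θ x y → θ (sim x y) ⊤ ∧ θ (bsim x y) ⊤ := by
    rintro θ ⟨e, c⟩ x y h
    have hrel := c _ _ _ _ h (e.refl y)
    rw [(F2 y).1, (F2 y).2] at hrel
    exact ⟨hrel.1, hrel.2.1⟩
  have rel_eq : ∀ θ, isCon θ →
      (fun x y : X => θ (sim x y) ⊤ ∧ θ (sim y x) ⊤ ∧ θ (bsim x y) ⊤ ∧ θ (bsim y x) ⊤) = θ := by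
    intro θ hθ
    funext x y
    refine propext ⟨fun h => rel_of_sim θ hθ x y h.1 h.2.1, fun h => ?_⟩
    have hxy := sim_of_rel θ hθ x y h
    have hyx := sim_of_rel θ hθ y x (hθ.1.symm h)
    exact ⟨hxy.1, hyx.1, hxy.2, hyx.2⟩
  have kernel_eq : ∀ F : Set X, isNCDS F →
      {x : X | sim x ⊤ ∈ F ∧ sim ⊤ x ∈ F ∧ bsim x ⊤ ∈ F ∧ bsim ⊤ x ∈ F} = F := by
    rintro F ⟨top, -, -, closed, -⟩
    ext x
    refine ⟨fun h => (F3 x).1 ▸ h.1, fun h => ?_⟩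
    exact ⟨(closed x h ⊤ top).1, (closed ⊤ top x h).1, (closed x h ⊤ top).2,
      (closed ⊤ top x h).2⟩
  have isNCDS_kernel : ∀ θ, isCon θ → isNCDS {x | θ x ⊤} := by
    intro θ hθ
    have ⟨e, c⟩ := hθ
    refine ⟨e.refl ⊤, fun a b ha hab => ?_, fun a b ha hba => ?_, fun x hx y hy => ?_,
      fun x y => ⟨fun h => ?_, fun h => ?_⟩⟩
    · have hrel := (c _ _ _ _ ha (e.refl b)).2.2
      rw [inf_eq_left.mpr hab, top_inf_eq] at hrel
      exact e.trans (e.symm hrel) ha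
    · have hrel := (c _ _ _ _ (e.refl b) ha).1
      rw [(F3 b).1] at hrel
      exact e.trans (e.symm hrel) hba
    · have hrel := c _ _ _ _ hx hy
      rw [(F2 ⊤).1, (F2 ⊤).2] at hrel
      exact ⟨hrel.1, hrel.2.1⟩
    · have hrel := rel_of_sim θ hθ x y h.1 h.2
      exact ⟨(sim_of_rel θ hθ x y hrel).2, (sim_of_rel θ hθ y x (e.symm hrel)).2⟩
    · have hrel := rel_of_bsim θ hθ x y h.1 h.2
      exact ⟨(sim_of_rel θ hθ x y hrel).1, (sim_of_rel θ hθ y x (e.symm hrel)).1⟩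
  have isCon_of_isNCDS : ∀ F : Set X, isNCDS F →
      isCon fun x y => sim x y ∈ F ∧ sim y x ∈ F ∧ bsim x y ∈ F ∧ bsim y x ∈ F := by
    rintro F ⟨top, up, mp, -, normal⟩
    let R : X → X → Prop :=
      fun x y => sim x y ∈ F ∧ sim y x ∈ F ∧ bsim x y ∈ F ∧ bsim y x ∈ F
    have of_sim : ∀ {x y}, sim x y ∈ F → sim y x ∈ F → R x y :=
      fun {x y} h h' => ⟨h, h', (normal x y).mp ⟨h, h'⟩⟩
    have of_bsim : ∀ {x y}, bsim x y ∈ F → bsim y x ∈ F → R x y := fun {x y} h h' =>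
      ⟨((normal x y).mpr ⟨h, h'⟩).1, ((normal x y).mpr ⟨h, h'⟩).2, h, h'⟩
    have trans : ∀ {x y z}, R x y → R y z → R x z := fun {x y z} h h' =>
      of_sim (mp _ _ h'.1 (up _ _ h.1 (F7 x y z).1))
        (mp _ _ h.2.1 (up _ _ h'.2.1 (F7 z y x).1))
    have equiv : Equivalence R :=
      ⟨fun x => of_sim ((F2 x).1 ▸ top) ((F2 x).1 ▸ top),
        fun h => ⟨h.2.1, h.1, h.2.2.2, h.2.2.1⟩, trans⟩
    refine ⟨equiv, fun a b x y hab hxy => ⟨?_, ?_, ?_⟩⟩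
    · exact trans (y := sim b x)
        (of_sim (up _ _ hab.1 (F7 a b x).1) (up _ _ hab.2.1 (F7 b a x).1))
        (of_bsim (up _ _ hxy.1 (F6 x y b).1) (up _ _ hxy.2.1 (F6 y x b).1))
    · exact trans (y := bsim b x)
        (of_sim (up _ _ hab.2.2.1 (F6 a b x).2) (up _ _ hab.2.2.2 (F6 b a x).2))
        (of_bsim (up _ _ hxy.2.2.1 (F7 x y b).2) (up _ _ hxy.2.2.2 (F7 y x b).2))
    · refine trans (y := b ⊓ x)
        (of_sim (up _ _ hab.1 (F5 a b x).1) (up _ _ hab.2.1 (F5 b a x).1)) ?_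
      rw [inf_comm b x, inf_comm b y]
      exact of_sim (up _ _ hxy.1 (F5 x y b).1) (up _ _ hxy.2.1 (F5 y x b).1)
  refine ⟨⟨isNCDS_kernel, fun θ hθ η hη h => ?_, fun F hF => ?_⟩, rel_eq, kernel_eq⟩
  · have hmem : ∀ x, θ x ⊤ = η x ⊤ := fun x => congrArg (x ∈ ·) h
    rw [← rel_eq θ hθ, ← rel_eq η hη]
    simp only [hmem]
  · exact ⟨_, isCon_of_isNCDS F hF, kernel_eq F hF⟩
end

section
/- Let (X; ∼, ∽, ∧, 1) be a pseudo equality algebra and F a normal deductive system of X. Then the quotient X/F of X by the congruence θ_F, with operations x/F ≃ y/F := (x ∼ y)/F, x/F ≂ y/F := (x ∽ y)/F and x/F ⊓ y/F := (x ∧ y)/F and constant 1/F, is well defined and is a pseudo equality algebra (in particular, the quotient satisfies the order axiom (F4) with respect to the semilattice order induced by ⊓). -/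
/-- Theorem 5.7: for a normal deductive system `F` of a pseudo equality algebra, the
relation `θ_F` (here `R`) is a congruence and the quotient `X/F`, with the induced
operations and order (`x/F ≤ y/F` iff `R (x ⊓ y) x`), is a pseudo equality algebra. -/
theorem pseudoEquality_quotient (X : Type*) [SemilatticeInf X] [OrderTop X]
    (sim bsim : X → X → X)
    (F2 : ∀ a : X, sim a a = ⊤ ∧ bsim a a = ⊤)
    (F3 : ∀ a : X, sim a ⊤ = a ∧ bsim ⊤ a = a)
    (F4 : ∀ a b c : X, a ≤ b → b ≤ c →
      sim a c ≤ sim b c ∧ sim a c ≤ sim a b ∧ bsim c a ≤ bsim c b ∧ bsim c a ≤ bsim b a)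
    (F5 : ∀ a b c : X, sim a b ≤ sim (a ⊓ c) (b ⊓ c) ∧ bsim a b ≤ bsim (a ⊓ c) (b ⊓ c))
    (F6 : ∀ a b c : X, sim a b ≤ bsim (sim c a) (sim c b) ∧ bsim a b ≤ sim (bsim a c) (bsim b c))
    (F7 : ∀ a b c : X, sim a b ≤ sim (sim a c) (sim b c) ∧ bsim a b ≤ bsim (bsim c a) (bsim c b))
    (F : Set X) (h1 : (⊤ : X) ∈ F)
    (hup : ∀ a b : X, a ∈ F → a ≤ b → b ∈ F)
    (hded : ∀ a b : X, a ∈ F → sim b a ∈ F → b ∈ F)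
    (hnormal : ∀ x y : X, (sim x y ∈ F ∧ sim y x ∈ F) ↔ (bsim x y ∈ F ∧ bsim y x ∈ F)) :
    letI R : X → X → Prop := fun x y => sim x y ∈ F ∧ sim y x ∈ F
    letI qle : X → X → Prop := fun x y => R (x ⊓ y) x
    Equivalence R ∧
    (∀ a b x y : X, R a b → R x y →
      R (sim a x) (sim b y) ∧ R (bsim a x) (bsim b y) ∧ R (a ⊓ x) (b ⊓ y)) ∧
    (∀ a : X, qle a ⊤) ∧
    (∀ a : X, R (sim a a) ⊤ ∧ R (bsim a a) ⊤) ∧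
    (∀ a : X, R (sim a ⊤) a ∧ R (bsim ⊤ a) a) ∧
    (∀ a b c : X, qle a b → qle b c →
      qle (sim a c) (sim b c) ∧ qle (sim a c) (sim a b) ∧
      qle (bsim c a) (bsim c b) ∧ qle (bsim c a) (bsim b a)) ∧
    (∀ a b c : X, qle (sim a b) (sim (a ⊓ c) (b ⊓ c)) ∧ qle (bsim a b) (bsim (a ⊓ c) (b ⊓ c))) ∧
    (∀ a b c : X, qle (sim a b) (bsim (sim c a) (sim c b)) ∧
      qle (bsim a b) (sim (bsim a c) (bsim b c))) ∧
    (∀ a b c : X, qle (sim a b) (sim (sim a c) (sim b c)) ∧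
      qle (bsim a b) (bsim (bsim c a) (bsim c b))) := by
  let R : X → X → Prop := fun x y => sim x y ∈ F ∧ sim y x ∈ F
  let qle : X → X → Prop := fun x y => R (x ⊓ y) x
  have refl (a : X) : R a a := by
    have h : sim a a ∈ F := (F2 a).1 ▸ h1
    exact ⟨h, h⟩
  have symm {a b : X} (h : R a b) : R b a := ⟨h.2, h.1⟩
  have mem_trans {a b c : X} (hab : sim a b ∈ F) (hbc : sim b c ∈ F) : sim a c ∈ F :=
    hded _ _ hbc (hup _ _ hab (F7 a b c).1)
  have trans {a b c : X} (hab : R a b) (hbc : R b c) : R a c :=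
    ⟨mem_trans hab.1 hbc.1, mem_trans hbc.2 hab.2⟩
  have of_eq {a b : X} (h : a = b) : R a b := h ▸ refl a
  have of_bsim {a b : X} (hab : bsim a b ∈ F) (hba : bsim b a ∈ F) : R a b :=
    (hnormal a b).2 ⟨hab, hba⟩
  have sim_congr {a b x y : X} (hab : R a b) (hxy : R x y) : R (sim a x) (sim b y) :=
    trans (b := sim b x)
      ⟨hup _ _ hab.1 (F7 a b x).1, hup _ _ hab.2 (F7 b a x).1⟩
      (of_bsim (hup _ _ hxy.1 (F6 x y b).1) (hup _ _ hxy.2 (F6 y x b).1))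
  have bsim_congr {a b x y : X} (hab : R a b) (hxy : R x y) : R (bsim a x) (bsim b y) := by
    have hab' := (hnormal a b).1 hab
    have hxy' := (hnormal x y).1 hxy
    exact trans (b := bsim b x)
      ⟨hup _ _ hab'.1 (F6 a b x).2, hup _ _ hab'.2 (F6 b a x).2⟩
      (of_bsim (hup _ _ hxy'.1 (F7 x y b).2) (hup _ _ hxy'.2 (F7 y x b).2))
  have inf_congr_left {a b : X} (c : X) (hab : R a b) : R (a ⊓ c) (b ⊓ c) :=
    ⟨hup _ _ hab.1 (F5 a b c).1, hup _ _ hab.2 (F5 b a c).1⟩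
  have inf_congr {a b x y : X} (hab : R a b) (hxy : R x y) : R (a ⊓ x) (b ⊓ y) := by
    refine trans (inf_congr_left x hab) ?_
    simpa only [inf_comm b] using inf_congr_left b hxy
  have qle_of_le {a b : X} (h : a ≤ b) : qle a b := of_eq (inf_eq_left.2 h)
  have qle_congr {a b x y : X} (hab : R a b) (hxy : R x y) (h : qle a x) : qle b y :=
    trans (symm (inf_congr hab hxy)) (trans h hab)
  refine ⟨⟨refl, symm, trans⟩, fun a b x y hab hxy =>
    ⟨sim_congr hab hxy, bsim_congr hab hxy, inf_congr hab hxy⟩, fun a => qle_of_le le_top,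
    fun a => ⟨of_eq (F2 a).1, of_eq (F2 a).2⟩, fun a => ⟨of_eq (F3 a).1, of_eq (F3 a).2⟩, ?_,
    fun a b c => ⟨qle_of_le (F5 a b c).1, qle_of_le (F5 a b c).2⟩,
    fun a b c => ⟨qle_of_le (F6 a b c).1, qle_of_le (F6 a b c).2⟩,
    fun a b c => ⟨qle_of_le (F7 a b c).1, qle_of_le (F7 a b c).2⟩⟩
  -- Replace `a` and `b` by the equivalent `a ⊓ (b ⊓ c) ≤ b ⊓ c ≤ c` and apply `F4` there.
  intro a b c hab hbc
  have hb : R (b ⊓ c) b := hbc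
  have ha : R (a ⊓ (b ⊓ c)) a := trans (inf_congr (refl a) hb) hab
  obtain ⟨h₁, h₂, h₃, h₄⟩ := F4 (a ⊓ (b ⊓ c)) (b ⊓ c) c inf_le_right inf_le_right
  exact ⟨qle_congr (sim_congr ha (refl c)) (sim_congr hb (refl c)) (qle_of_le h₁),
    qle_congr (sim_congr ha (refl c)) (sim_congr ha hb) (qle_of_le h₂),
    qle_congr (bsim_congr (refl c) ha) (bsim_congr (refl c) hb) (qle_of_le h₃),
    qle_congr (bsim_congr (refl c) ha) (bsim_congr hb ha) (qle_of_le h₄)⟩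
end
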